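/- In a q-topos, for every morphism f : A → B the pullback map f* : StrongSub(B) → StrongSub(A) between strong subobject posets has both a left adjoint ∃_f and a right adjoint ∀_f as monotone maps: for all strong subobjects φ of A and ψ of B, ∃_f(φ) ≤ ψ iff φ ≤ f*(ψ), and f*(ψ) ≤ φ iff ψ ≤ ∀_f(φ). -/

import Mathlib

open CategoryTheory CategoryTheory.Limits

universe w v u

namespace QToposPaper

variable {C : Type u} [Category.{v} C]

/-- A morphism `g` is left orthogonal to a morphism `m` if every commuting square from `g`
to `m` admits a unique diagonal filler. -/
def LeftOrthogonal {A B X Y : C} (g : A ⟶ B) (m : X ⟶ Y) : Prop :=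
  ∀ (u : A ⟶ X) (v : B ⟶ Y), u ≫ m = g ≫ v →
    ∃! l : B ⟶ X, g ≫ l = u ∧ l ≫ m = v

/-- `t : U ⟶ Ω` is a generic strong monomorphism (i.e. a representation of the presheaf of
strong subobjects, phrased via its universal element): `t` is a strong monomorphism and every
strong monomorphism is a pullback of `t` along a unique classifying map. -/
def IsStrongSubClassifier {U Ω : C} (t : U ⟶ Ω) : Prop :=
  StrongMono t ∧
    ∀ {S X : C} (m : S ⟶ X), StrongMono m →
      ∃! χ : X ⟶ Ω, ∃ top : S ⟶ U, IsPullback top m t χ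

/-- `mem : E ⟶ P ⨯ A` exhibits `P` as a representing object for the presheaf
`X ↦ StrongSub (X ⨯ A)`, phrased via its universal element: every strong monomorphism into
`X ⨯ A` is a pullback of `mem` along a unique map `X ⟶ P`. -/
def IsWeakPowerObject [HasBinaryProducts C] (A : C) {P E : C} (mem : E ⟶ P ⨯ A) : Prop :=
  StrongMono mem ∧
    ∀ {S X : C} (m : S ⟶ X ⨯ A), StrongMono m →
      ∃! χ : X ⟶ P, ∃ top : S ⟶ E, IsPullback top m mem (prod.map χ (𝟙 A))

/-- `mem : E ⟶ P ⨯ A` exhibits `P` as a power object of `A`: every monomorphism into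
`X ⨯ A` is a pullback of `mem` along a unique map `X ⟶ P`. -/
def IsPowerObject [HasBinaryProducts C] (A : C) {P E : C} (mem : E ⟶ P ⨯ A) : Prop :=
  Mono mem ∧
    ∀ {S X : C} (m : S ⟶ X ⨯ A), Mono m →
      ∃! χ : X ⟶ P, ∃ top : S ⟶ E, IsPullback top m mem (prod.map χ (𝟙 A))

/-- `t : U ⟶ Ω` is a subobject classifier: every monomorphism is a pullback of `t` along a
unique classifying map. -/
def IsMonoClassifier {U Ω : C} (t : U ⟶ Ω) : Prop :=
  Mono t ∧
    ∀ {S X : C} (m : S ⟶ X), Mono m →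
      ∃! χ : X ⟶ Ω, ∃ top : S ⟶ U, IsPullback top m t χ

/-- An object `Ω` is exponentiating if for every object `X` the presheaf `C(- ⨯ X, Ω)` is
representable (phrased via a universal element `ev`). -/
def IsExponentiating [HasBinaryProducts C] (Ω : C) : Prop :=
  ∀ X : C, ∃ (E : C) (ev : E ⨯ X ⟶ Ω), ∀ {Y : C} (f : Y ⨯ X ⟶ Ω),
    ∃! g : Y ⟶ E, prod.map g (𝟙 X) ≫ ev = f

/-- A strong equivalence relation on `A`: a pair `r₁ r₂ : R ⟶ A` such that
`⟨r₁, r₂⟩ : R ⟶ A ⨯ A` is a strong monomorphism which is an internal equivalence relation. -/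
structure IsStrongEquivRel [HasBinaryProducts C] [HasPullbacks C]
    {R A : C} (r₁ r₂ : R ⟶ A) : Prop where
  strongMono : StrongMono (prod.lift r₁ r₂)
  refl : ∃ d : A ⟶ R, d ≫ r₁ = 𝟙 A ∧ d ≫ r₂ = 𝟙 A
  symm : ∃ s : R ⟶ R, s ≫ r₁ = r₂ ∧ s ≫ r₂ = r₁
  trans : ∃ t : pullback r₂ r₁ ⟶ R,
    t ≫ r₁ = pullback.fst r₂ r₁ ≫ r₁ ∧ t ≫ r₂ = pullback.snd r₂ r₁ ≫ r₂

/-- `r₁, r₂` admits an effective quotient: a coequalizer `e` of `r₁, r₂` whose kernel pair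
is `(r₁, r₂)`. -/
def HasEffectiveQuotient {R A : C} (r₁ r₂ : R ⟶ A) : Prop :=
  ∃ (Q : C) (e : A ⟶ Q) (w : r₁ ≫ e = r₂ ≫ e),
    Nonempty (IsColimit (Cofork.ofπ e w)) ∧ IsPullback r₁ r₂ e e

/-- A q-topos: a category with finite limits such that (i) for every object `A` the presheaf
`X ↦ StrongSub (X ⨯ A)` is representable, (ii) every strong equivalence relation has an
effective quotient, and (iii) regular epimorphisms are stable under pullback. -/
class QTopos (C : Type u) [Category.{v} C] [HasFiniteLimits C] : Prop where
  weakPowerObject : ∀ A : C, ∃ (P E : C) (mem : E ⟶ P ⨯ A), IsWeakPowerObject A mem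
  effectiveQuotient : ∀ {R A : C} (r₁ r₂ : R ⟶ A),
    IsStrongEquivRel r₁ r₂ → HasEffectiveQuotient r₁ r₂
  regularEpiStable : ∀ {P X Y Z : C} (p : P ⟶ X) (q : P ⟶ Z) (f : X ⟶ Y) (g : Z ⟶ Y),
    IsPullback p q f g → Nonempty (RegularEpi g) → Nonempty (RegularEpi p)

/-- The poset of strong subobjects of `X`. -/
def StrongSub (X : C) : Type (max u v) := { S : Subobject X // StrongMono S.arrow }

instance (X : C) : PartialOrder (StrongSub X) := Subtype.partialOrder _

/-- An object `X` is coarse if every morphism into `X` extends (necessarily uniquely) along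
any morphism which is simultaneously a monomorphism and an epimorphism. -/
def Coarse (X : C) : Prop :=
  ∀ {A B : C} (f : A ⟶ B), Mono f → Epi f → ∀ g : A ⟶ X, ∃ h : B ⟶ X, f ≫ h = g

end QToposPaper

open QToposPaper CategoryTheory CategoryTheory.Limits

namespace QToposAux

section
attribute [local simp] Limits.prod.lift_fst Limits.prod.lift_snd Limits.prod.lift_fst_assoc
  Limits.prod.lift_snd_assoc
variable {C : Type u} [Category.{v} C]

/-- Generalised-element membership. -/
def Fac {S X Z : C} (m : S ⟶ X) (x : Z ⟶ X) : Prop := ∃ k : Z ⟶ S, k ≫ m = x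

lemma Fac.comp {S X Z W : C} {m : S ⟶ X} {x : Z ⟶ X} (h : Fac m x) (w : W ⟶ Z) :
    Fac m (w ≫ x) := by
  obtain ⟨k, hk⟩ := h
  exact ⟨w ≫ k, by rw [Category.assoc, hk]⟩

lemma strongMono_of_isPullback {S' S X' X : C} {top : S' ⟶ S} {m' : S' ⟶ X'} {m : S ⟶ X}
    {f : X' ⟶ X} (h : IsPullback top m' m f) (hm : StrongMono m) : StrongMono m' where
  mono := by
    refine ⟨fun a b hab => h.hom_ext ?_ hab⟩
    rw [← cancel_mono m, Category.assoc, Category.assoc, h.w, reassoc_of% hab]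
  rlp := by
    intro P Q z _
    refine ⟨fun {u v} sq => ?_⟩
    have sq2 : CommSq (u ≫ top) z m (v ≫ f) := ⟨by
      rw [Category.assoc, h.w, reassoc_of% sq.w]⟩
    refine ⟨⟨⟨h.lift sq2.lift v sq2.fac_right, ?_, by simp⟩⟩⟩
    apply h.hom_ext <;> simp [sq.w]

lemma fac_of_isPullback {S' S X' X Z : C} {top : S' ⟶ S} {m' : S' ⟶ X'} {m : S ⟶ X}
    {f : X' ⟶ X} (h : IsPullback top m' m f) (x : Z ⟶ X') : Fac m' x ↔ Fac m (x ≫ f) := by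
  constructor
  · rintro ⟨k, rfl⟩
    exact ⟨k ≫ top, by simp [h.w]⟩
  · rintro ⟨k, hk⟩
    exact ⟨h.lift k x hk, by simp⟩

variable [HasFiniteLimits C]

lemma exists_pullback {S X' X : C} (m : S ⟶ X) (hm : StrongMono m) (f : X' ⟶ X) :
    ∃ (S' : C) (m' : S' ⟶ X'), StrongMono m' ∧
      ∀ {Z : C} (x : Z ⟶ X'), Fac m' x ↔ Fac m (x ≫ f) :=
  ⟨_, pullback.snd m f, strongMono_of_isPullback (IsPullback.of_hasPullback m f) hm,
    fun x => fac_of_isPullback (IsPullback.of_hasPullback m f) x⟩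

lemma comprehension {A P E : C} {mem : E ⟶ P ⨯ A} (h : IsWeakPowerObject A mem)
    {S X : C} (m : S ⟶ X ⨯ A) (hm : StrongMono m) :
    ∃ χ : X ⟶ P, ∀ {Z : C} (x : Z ⟶ X) (a : Z ⟶ A),
      Fac mem (prod.lift (x ≫ χ) a) ↔ Fac m (prod.lift x a) := by
  obtain ⟨χ, ⟨top, ht⟩, -⟩ := h.2 m hm
  refine ⟨χ, fun x a => ?_⟩
  rw [fac_of_isPullback ht]
  simp

lemma extensionality {A P E : C} {mem : E ⟶ P ⨯ A} (h : IsWeakPowerObject A mem)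
    {T : C} (p q : T ⟶ P)
    (hpq : ∀ {Z : C} (t : Z ⟶ T) (a : Z ⟶ A),
      Fac mem (prod.lift (t ≫ p) a) ↔ Fac mem (prod.lift (t ≫ q) a)) : p = q := by
  have hp := IsPullback.of_hasPullback mem (prod.map p (𝟙 A))
  have hm := strongMono_of_isPullback hp h.1
  have hmono := h.1.mono
  have hmono' := hm.mono
  have key : ∀ {Z : C} (y : Z ⟶ T ⨯ A),
      Fac (pullback.snd mem (prod.map p (𝟙 A))) y ↔ Fac mem (y ≫ prod.map q (𝟙 A)) := by
    intro Z y
    rw [fac_of_isPullback hp]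
    have e : ∀ r : T ⟶ P, y ≫ prod.map r (𝟙 A) =
        prod.lift ((y ≫ prod.fst) ≫ r) (y ≫ prod.snd) := by
      intro r
      apply Limits.prod.hom_ext <;> simp
    rw [e, e]
    exact hpq _ _
  obtain ⟨top, htop⟩ := (key (pullback.snd mem (prod.map p (𝟙 A)))).1 ⟨𝟙 _, by simp⟩
  refine (h.2 _ hm).unique ⟨_, hp⟩ ⟨top, ⟨⟨htop⟩, ⟨PullbackCone.IsLimit.mk _
    (fun s => ((key s.snd).2 ⟨s.fst, s.condition⟩).choose) ?_ ?_ ?_⟩⟩⟩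
  · intro s
    have hk := ((key s.snd).2 ⟨s.fst, s.condition⟩).choose_spec
    rw [← cancel_mono mem, Category.assoc, htop, reassoc_of% hk, s.condition]
  · intro s
    exact ((key s.snd).2 ⟨s.fst, s.condition⟩).choose_spec
  · intro s l _ h2
    rw [← cancel_mono (pullback.snd mem (prod.map p (𝟙 A))), h2]
    exact ((key s.snd).2 ⟨s.fst, s.condition⟩).choose_spec.symm

lemma strongMono_graph {A B : C} (f : A ⟶ B) : StrongMono (prod.lift f (𝟙 A)) := by
  have : IsSplitMono (prod.lift f (𝟙 A)) := ⟨⟨⟨prod.snd, by simp⟩⟩⟩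
  infer_instance

lemma fac_graph {A B S Z : C} (f : A ⟶ B) (m : S ⟶ A) (b : Z ⟶ B) (a : Z ⟶ A) :
    Fac (m ≫ prod.lift f (𝟙 A)) (prod.lift b a) ↔ a ≫ f = b ∧ Fac m a := by
  constructor
  · rintro ⟨k, hk⟩
    have h1 := congrArg (· ≫ prod.fst) hk
    have h2 := congrArg (· ≫ prod.snd) hk
    simp at h1 h2
    exact ⟨by rw [← h1, ← h2]; simp, ⟨k, h2⟩⟩
  · rintro ⟨rfl, k, rfl⟩
    exact ⟨k, by apply Limits.prod.hom_ext <;> simp⟩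

variable [QTopos C]

/-- Universal quantification. -/
lemma exists_forall {A B S : C} (f : A ⟶ B) (m : S ⟶ A) (hm : StrongMono m) :
    ∃ (N : C) (n : N ⟶ B), StrongMono n ∧ ∀ {T : C} (g : T ⟶ B),
      Fac n g ↔ ∀ (Z : C) (t : Z ⟶ T) (a : Z ⟶ A), a ≫ f = t ≫ g → Fac m a := by
  obtain ⟨P, E, mem, h⟩ := QTopos.weakPowerObject (C := C) A
  have hg := strongMono_graph f
  obtain ⟨χ₁, h₁⟩ := comprehension h (𝟙 A ≫ prod.lift f (𝟙 A)) (by simpa using hg)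
  obtain ⟨χ₂, h₂⟩ := comprehension h (m ≫ prod.lift f (𝟙 A)) inferInstance
  refine ⟨_, equalizer.ι χ₁ χ₂, inferInstance, fun {T} g => ?_⟩
  have e : Fac (equalizer.ι χ₁ χ₂) g ↔ g ≫ χ₁ = g ≫ χ₂ := by
    constructor
    · rintro ⟨k, rfl⟩
      rw [Category.assoc, Category.assoc, equalizer.condition]
    · intro hh
      exact ⟨equalizer.lift g hh, by simp⟩
  have hid : ∀ {Z : C} (a : Z ⟶ A), Fac (𝟙 A) a := fun a => ⟨a, by simp⟩
  rw [e]
  constructor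
  · intro hh Z t a hta
    have h3 := (h₁ (t ≫ g) a).2 ((fac_graph _ _ _ _).2 ⟨hta, hid a⟩)
    rw [Category.assoc, hh, ← Category.assoc, h₂, fac_graph] at h3
    exact h3.2
  · intro hh
    apply extensionality h
    intro Z t a
    rw [← Category.assoc, ← Category.assoc, h₁, h₂, fac_graph, fac_graph]
    exact ⟨fun hx => ⟨hx.1, hh Z t a hx.1⟩, fun hx => ⟨hx.1, hid a⟩⟩

/-- Existential quantification / strong image. -/
lemma exists_image {S B : C} (g : S ⟶ B) :
    ∃ (N : C) (n : N ⟶ B), StrongMono n ∧ Fac n g ∧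
      ∀ {T : C} (m : T ⟶ B), StrongMono m → Fac m g → Fac m n := by
  obtain ⟨P, E, mem, h⟩ := QTopos.weakPowerObject (C := C) B
  obtain ⟨M, m₀, hm₀, hm₀'⟩ := exists_pullback mem h.1 (prod.map (𝟙 P) g)
  obtain ⟨K, k, hk, hk'⟩ := exists_forall (prod.fst : P ⨯ S ⟶ P) m₀ hm₀
  obtain ⟨L, l, hl, hl'⟩ := exists_pullback mem h.1 (prod.map k (𝟙 B))
  obtain ⟨N, n, hn, hn'⟩ := exists_forall (prod.snd : K ⨯ B ⟶ B) l hl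
  refine ⟨N, n, hn, ?_, ?_⟩
  · rw [hn']
    intro Z t a hta
    rw [hl']
    have h1 := (hk' k).1 ⟨𝟙 _, by simp⟩ Z (a ≫ prod.fst)
      (prod.lift (a ≫ prod.fst ≫ k) t) (by simp)
    rw [hm₀'] at h1
    convert h1 using 1
    apply Limits.prod.hom_ext <;> simp [hta]
  · intro T m hm hmg
    have hmt : StrongMono (m ≫ prod.lift (terminal.from B) (𝟙 B)) :=
      have := strongMono_graph (terminal.from B)
      inferInstance
    obtain ⟨χ, hχ⟩ := comprehension h _ hmt
    have hχ' : ∀ {Z : C} (x : Z ⟶ ⊤_ C) (b : Z ⟶ B),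
        Fac mem (prod.lift (x ≫ χ) b) ↔ Fac m b := by
      intro Z x b
      rw [hχ, fac_graph]
      exact ⟨fun hx => hx.2, fun hx => ⟨Subsingleton.elim _ _, hx⟩⟩
    obtain ⟨c, hc⟩ : Fac k χ := by
      rw [hk']
      intro Z t a hta
      rw [hm₀']
      have h2 := (hχ' t (a ≫ prod.snd ≫ g)).2 (by
        simpa using hmg.comp (a ≫ prod.snd))
      convert h2 using 1
      apply Limits.prod.hom_ext <;> simp [hta]
    have h3 := (hn' n).1 ⟨𝟙 _, by simp⟩ N (𝟙 _)
      (prod.lift (terminal.from N ≫ c) n) (by simp)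
    rw [hl'] at h3
    refine (hχ' (terminal.from N) n).1 ?_
    convert h3 using 1
    apply Limits.prod.hom_ext <;> simp [hc]

end

section
variable {C : Type u} [Category.{v} C]

lemma le_iff_fac {X : C} (S T : StrongSub X) : S ≤ T ↔ Fac T.1.arrow S.1.arrow := by
  constructor
  · intro h
    exact ⟨Subobject.ofLE S.1 T.1 h, Subobject.ofLE_arrow _⟩
  · rintro ⟨k, hk⟩
    exact Subobject.le_of_comm k hk

lemma exists_strongSub {N X : C} (n : N ⟶ X) (hn : StrongMono n) :
    ∃ S : StrongSub X, Fac S.1.arrow n ∧ Fac n S.1.arrow := by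
  have := hn.mono
  have hs : StrongMono (Subobject.mk n).arrow := by
    refine strongMono_of_isPullback (top := (Subobject.underlyingIso n).hom) (f := 𝟙 X)
      (IsPullback.of_horiz_isIso ⟨by simp⟩) hn
  exact ⟨⟨Subobject.mk n, hs⟩, ⟨(Subobject.underlyingIso n).inv, by simp⟩,
    ⟨(Subobject.underlyingIso n).hom, by simp⟩⟩

lemma Fac.trans {S X Y Z : C} {m : S ⟶ X} {n : Y ⟶ X} {x : Z ⟶ X} (h : Fac m n) (h' : Fac n x) :
    Fac m x := by
  obtain ⟨k, rfl⟩ := h'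
  exact h.comp k

end

end QToposAux

open QToposAux in
/-- In a q-topos, for every morphism `f : A ⟶ B` the monotone pullback map
`f* : StrongSub B → StrongSub A` has both a left adjoint `∃_f` and a right adjoint `∀_f`:
`∃_f φ ≤ ψ ↔ φ ≤ f* ψ` and `f* ψ ≤ φ ↔ ψ ≤ ∀_f φ`. -/
theorem strongSub_pullback_has_adjoints
    {C : Type u} [Category.{v} C] [HasFiniteLimits C] [QTopos C]
    {A B : C} (f : A ⟶ B) :
    ∃ (pb : StrongSub B →o StrongSub A)
      (ex : StrongSub A →o StrongSub B) (fa : StrongSub A →o StrongSub B),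
      (∀ T : StrongSub B, ∃ top : ((pb T).1 : C) ⟶ (T.1 : C),
        IsPullback top (pb T).1.arrow T.1.arrow f) ∧
      (∀ (φ : StrongSub A) (ψ : StrongSub B), ex φ ≤ ψ ↔ φ ≤ pb ψ) ∧
      (∀ (φ : StrongSub A) (ψ : StrongSub B), pb ψ ≤ φ ↔ ψ ≤ fa φ) := by
  have hpb := fun T : StrongSub B => Subobject.isPullback f T.1
  let pb : StrongSub B → StrongSub A := fun T =>
    ⟨(Subobject.pullback f).obj T.1, strongMono_of_isPullback (hpb T) T.2⟩
  have hpbF : ∀ (T : StrongSub B) {Z : C} (x : Z ⟶ A),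
      Fac (pb T).1.arrow x ↔ Fac T.1.arrow (x ≫ f) :=
    fun T _ x => fac_of_isPullback (hpb T) x
  have hex : ∀ φ : StrongSub A, ∃ e : StrongSub B, ∀ ψ, e ≤ ψ ↔ φ ≤ pb ψ := by
    intro φ
    obtain ⟨N, n, hn, h1, h2⟩ := exists_image (φ.1.arrow ≫ f)
    obtain ⟨e, he1, he2⟩ := exists_strongSub n hn
    refine ⟨e, fun ψ => ?_⟩
    rw [le_iff_fac, le_iff_fac, hpbF]
    exact ⟨fun h => (h.trans he1).trans h1, fun h => (h2 _ ψ.2 h).trans he2⟩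
  have hfa : ∀ φ : StrongSub A, ∃ e : StrongSub B, ∀ ψ, pb ψ ≤ φ ↔ ψ ≤ e := by
    intro φ
    obtain ⟨N, n, hn, h1⟩ := exists_forall f φ.1.arrow φ.2
    obtain ⟨e, he1, he2⟩ := exists_strongSub n hn
    refine ⟨e, fun ψ => ?_⟩
    rw [le_iff_fac, le_iff_fac]
    have h3 : Fac e.1.arrow ψ.1.arrow ↔ Fac n ψ.1.arrow :=
      ⟨fun h => he2.trans h, fun h => he1.trans h⟩
    rw [h3, h1]
    constructor
    · intro h Z t a hta
      exact h.trans ((hpbF ψ a).2 ⟨t, hta.symm⟩)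
    · intro h
      exact h _ _ _ (hpb ψ).w.symm
  choose ex hex using hex
  choose fa hfa using hfa
  have mpb : Monotone pb := fun S T h => by
    rw [← hex]
    exact ((hex _ _).2 le_rfl).trans h
  refine ⟨⟨pb, mpb⟩, ⟨ex, fun S T h => ?_⟩, ⟨fa, fun S T h => ?_⟩,
    fun T => ⟨_, hpb T⟩, hex, hfa⟩
  · rw [hex]
    exact h.trans ((hex _ _).1 le_rfl)
  · rw [← hfa]
    exact ((hfa _ _).2 le_rfl).trans h
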